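/- Let p be a prime with p ∤ N and let r be a positive integer. Then for every f ∈ M₀^{!,∞}(Γ), the function f|T(p^r) also belongs to M₀^{!,∞}(Γ); that is, the generalized Hecke operator T(p^r) preserves the space M₀^{!,∞}(Γ). -/

import Mathlib

open Complex UpperHalfPlane Matrix

/-- `q = e^{2πiτ}`. -/
noncomputable def qexp (τ : UpperHalfPlane) : ℂ := Complex.exp (2 * Real.pi * Complex.I * (τ : ℂ))

/-- Weight-0 invariance of `f : ℍ → ℂ` under the Möbius transformation attached to an
integer matrix `A` (with positive determinant). -/
def MoebInv (A : Matrix (Fin 2) (Fin 2) ℤ) (f : UpperHalfPlane → ℂ) : Prop :=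
  ∀ τ τ' : UpperHalfPlane,
    (τ' : ℂ) = ((A 0 0 : ℂ) * τ + A 0 1) / ((A 1 0 : ℂ) * τ + A 1 1) → f τ' = f τ

/-- Weight-2 invariance of `f : ℍ → ℂ` under the slash action of an integer matrix `A`. -/
def Slash2Inv (A : Matrix (Fin 2) (Fin 2) ℤ) (f : UpperHalfPlane → ℂ) : Prop :=
  ∀ τ τ' : UpperHalfPlane,
    (τ' : ℂ) = ((A 0 0 : ℂ) * τ + A 0 1) / ((A 1 0 : ℂ) * τ + A 1 1) →
      (A.det : ℂ) * f τ' = ((A 1 0 : ℂ) * τ + A 1 1) ^ 2 * f τ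

/-- `f : ℍ → ℂ` is holomorphic on `ℍ`: it is the restriction of a function differentiable
on the open upper half-plane. -/
def HoloOnH (f : UpperHalfPlane → ℂ) : Prop :=
  ∃ F : ℂ → ℂ, DifferentiableOn ℂ F {z : ℂ | 0 < z.im} ∧ ∀ τ : UpperHalfPlane, f τ = F τ

/-- Generators of the group `Γ = N+S` inside `GL(2,ℚ)`: the elements of `Γ₀(N)` together
with the Atkin–Lehner matrices `W_{Q,N}` for `Q ∈ S` (up to the scalar normalization,
which does not affect the corresponding fractional linear transformation). -/
def GammaGens (N : ℕ) (S : Finset ℕ) : Set (GL (Fin 2) ℚ) :=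
  { A | (∃ a b c d : ℤ, a * d - b * c = 1 ∧ (N : ℤ) ∣ c ∧
          (A : Matrix (Fin 2) (Fin 2) ℚ) = !![(a : ℚ), (b : ℚ); (c : ℚ), (d : ℚ)]) ∨
        (∃ Q ∈ S, ∃ x y z w : ℤ,
          (A : Matrix (Fin 2) (Fin 2) ℚ) =
            !![(Q : ℚ) * x, (y : ℚ); (N : ℚ) * z, (Q : ℚ) * w] ∧
          (A : Matrix (Fin 2) (Fin 2) ℚ).det = (Q : ℚ)) }

/-- The group `Γ = N+S`, realized as a subgroup of `GL(2,ℚ)`. -/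
def GammaGrp (N : ℕ) (S : Finset ℕ) : Subgroup (GL (Fin 2) ℚ) :=
  Subgroup.closure (GammaGens N S)

/-- The cusp represented in projective coordinates by the integer column `(a, c)`
is `Γ`-equivalent to the cusp `i∞` (represented by `(1, 0)`). -/
def CuspEquivInf (N : ℕ) (S : Finset ℕ) (a c : ℤ) : Prop :=
  ∃ g ∈ GammaGrp N S, ∃ k : ℚ, k ≠ 0 ∧
    (g : Matrix (Fin 2) (Fin 2) ℚ) *ᵥ ![1, 0] = k • ![(a : ℚ), (c : ℚ)]

/-- Membership in `M₀^{!,∞}(Γ)` for `Γ = N+S`: holomorphic on `ℍ`, invariant under `Γ₀(N)`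
and the Atkin–Lehner involutions `W_{Q,N}` (`Q ∈ S`), meromorphic at `i∞` (a Fourier
expansion `Σ_{n ≥ -m} c(n) qⁿ`), and bounded (holomorphic) at every cusp that is not
`Γ`-equivalent to `i∞`. -/
def MemM0 (N : ℕ) (S : Finset ℕ) (f : UpperHalfPlane → ℂ) : Prop :=
  HoloOnH f ∧
  (∀ a b c d : ℤ, a * d - b * c = 1 → (N : ℤ) ∣ c → MoebInv !![a, b; c, d] f) ∧
  (∀ Q ∈ S, ∀ x y z w : ℤ,
      (Matrix.det !![(Q : ℤ) * x, y; (N : ℤ) * z, (Q : ℤ) * w] = (Q : ℤ)) →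
      MoebInv !![(Q : ℤ) * x, y; (N : ℤ) * z, (Q : ℤ) * w] f) ∧
  (∃ m : ℕ, ∃ c : ℤ → ℂ, (∀ n : ℤ, n < -(m : ℤ) → c n = 0) ∧
      ∀ τ : UpperHalfPlane, HasSum (fun n : ℤ => c n * qexp τ ^ n) (f τ)) ∧
  (∀ σa σb σc σd : ℤ, σa * σd - σb * σc = 1 → ¬ CuspEquivInf N S σa σc →
      ∃ C A : ℝ, ∀ τ τ' : UpperHalfPlane, A ≤ τ.im →
        (τ' : ℂ) = ((σa : ℂ) * τ + σb) / ((σc : ℂ) * τ + σd) → ‖f τ'‖ ≤ C)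

/-- Membership in `S₂(Γ)`: weight-2 cusp forms: holomorphic on `ℍ`, weight-2 invariant
under `Γ₀(N)` and the Atkin–Lehner involutions, and vanishing at every cusp. -/
def MemS2 (N : ℕ) (S : Finset ℕ) (f : UpperHalfPlane → ℂ) : Prop :=
  HoloOnH f ∧
  (∀ a b c d : ℤ, a * d - b * c = 1 → (N : ℤ) ∣ c → Slash2Inv !![a, b; c, d] f) ∧
  (∀ Q ∈ S, ∀ x y z w : ℤ,
      (Matrix.det !![(Q : ℤ) * x, y; (N : ℤ) * z, (Q : ℤ) * w] = (Q : ℤ)) →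
      Slash2Inv !![(Q : ℤ) * x, y; (N : ℤ) * z, (Q : ℤ) * w] f) ∧
  (∀ σa σb σc σd : ℤ, σa * σd - σb * σc = 1 → ∀ ε : ℝ, 0 < ε →
      ∃ A : ℝ, ∀ τ τ' : UpperHalfPlane, A ≤ τ.im →
        (τ' : ℂ) = ((σa : ℂ) * τ + σb) / ((σc : ℂ) * τ + σd) →
        ‖f τ'‖ ≤ ε * ‖(σc : ℂ) * τ + σd‖ ^ 2)

/-- Membership in `S₂^{!,∞}(Γ)`: weight-2 weakly holomorphic modular forms whose poles are
supported only at `i∞` and which vanish at all other cusps. -/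
def MemS2Weak (N : ℕ) (S : Finset ℕ) (f : UpperHalfPlane → ℂ) : Prop :=
  HoloOnH f ∧
  (∀ a b c d : ℤ, a * d - b * c = 1 → (N : ℤ) ∣ c → Slash2Inv !![a, b; c, d] f) ∧
  (∀ Q ∈ S, ∀ x y z w : ℤ,
      (Matrix.det !![(Q : ℤ) * x, y; (N : ℤ) * z, (Q : ℤ) * w] = (Q : ℤ)) →
      Slash2Inv !![(Q : ℤ) * x, y; (N : ℤ) * z, (Q : ℤ) * w] f) ∧
  (∃ m : ℕ, ∃ c : ℤ → ℂ, (∀ n : ℤ, n < -(m : ℤ) → c n = 0) ∧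
      ∀ τ : UpperHalfPlane, HasSum (fun n : ℤ => c n * qexp τ ^ n) (f τ)) ∧
  (∀ σa σb σc σd : ℤ, σa * σd - σb * σc = 1 → ¬ CuspEquivInf N S σa σc → ∀ ε : ℝ, 0 < ε →
      ∃ A : ℝ, ∀ τ τ' : UpperHalfPlane, A ≤ τ.im →
        (τ' : ℂ) = ((σa : ℂ) * τ + σb) / ((σc : ℂ) * τ + σd) →
        ‖f τ'‖ ≤ ε * ‖(σc : ℂ) * τ + σd‖ ^ 2)
lemma hecke_im_pos (p r i v : ℕ) (hp : 0 < p) (τ : UpperHalfPlane) :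
    0 < ((((p : ℂ) ^ i * τ + v) / (p : ℂ) ^ (r - i))).im := by
  have hcast : ((p : ℂ) ^ (r - i)) = (((p ^ (r - i) : ℕ) : ℝ) : ℂ) := by push_cast; ring
  have hcast2 : ((p : ℂ) ^ i * τ + v).im = (p : ℝ) ^ i * τ.im := by
    have hpow : ((p : ℂ) ^ i) = ((((p : ℝ) ^ i : ℝ)) : ℂ) := by push_cast; ring
    rw [hpow, Complex.add_im, Complex.mul_im, Complex.ofReal_re, Complex.ofReal_im]
    simp [UpperHalfPlane.coe_im]
  rw [hcast, div_eq_mul_inv, ← Complex.ofReal_inv, Complex.mul_im]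
  rw [Complex.ofReal_re, Complex.ofReal_im]
  have h1 : (0 : ℝ) < ((p ^ (r - i) : ℕ) : ℝ) := by positivity
  have h2 : (0 : ℝ) < τ.im := τ.2
  rw [hcast2]
  have : (0:ℝ) < (p:ℝ) ^ i * τ.im * (((p ^ (r - i) : ℕ) : ℝ))⁻¹ := by positivity
  simpa using this

/-- The generalized Hecke operator `T(p^r)` for `p ∤ N`:
`(f|T(p^r))(τ) = Σ_{i=0}^{r} Σ_{v=0}^{p^{r-i}-1} f((p^i τ + v)/p^{r-i})`. -/
noncomputable def heckeT (p r : ℕ) (hp : 0 < p) (f : UpperHalfPlane → ℂ)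
    (τ : UpperHalfPlane) : ℂ :=
  ∑ i ∈ Finset.range (r + 1), ∑ v ∈ Finset.range (p ^ (r - i)),
    f ⟨((p : ℂ) ^ i * τ + v) / (p : ℂ) ^ (r - i), hecke_im_pos p r i v hp τ⟩

/-- An upper triangular integer matrix of determinant `p ^ r` can be moved from the left to the
right of an Atkin–Lehner type matrix `!![Q x, y; N z, Q w]` of determinant `Q`. -/
lemma exists_upperTri_exchange {N Q p r : ℕ} (hQN : Q ∣ N) (hN : 0 < N)
    (hp : p.Prime) (hpN : ¬ p ∣ N) {a b d x y z w : ℤ} (ha : 0 < a) (had : a * d = (p : ℤ) ^ r)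
    (hdet : (Q * x) * (Q * w) - y * (N * z) = (Q : ℤ)) :
    ∃ a' b' d' x' y' z' w' : ℤ, 0 < a' ∧ 0 ≤ b' ∧ b' < d' ∧ a' * d' = (p : ℤ) ^ r ∧
      (Q * x') * (Q * w') - y' * (N * z') = (Q : ℤ) ∧
      a * (Q * x) + b * (N * z) = Q * x' * a' ∧
      a * y + b * (Q * w) = Q * x' * b' + y' * d' ∧
      d * (N * z) = N * z' * a' ∧
      d * (Q * w) = N * z' * b' + Q * w' * d' := by
  obtain ⟨M, rfl⟩ := hQN
  have hQ0 : (Q : ℤ) ≠ 0 := by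
    rintro h
    have : Q = 0 := by exact_mod_cast h
    simp [this] at hN
  have hpr : (0 : ℤ) < (p : ℤ) ^ r := pow_pos (by exact_mod_cast hp.pos) r
  have hd : 0 < d := by
    by_contra h
    nlinarith [mul_nonneg ha.le (by linarith : 0 ≤ -d)]
  have hcop : ∀ k : ℕ, IsCoprime ((p : ℤ) ^ k) ((Q * M : ℕ) : ℤ) := fun k =>
    IsCoprime.pow_left ((Nat.isCoprime_iff_coprime).2 ((Nat.Prime.coprime_iff_not_dvd hp).2 hpN))
  push_cast at hdet hcop ⊢
  have hdet1 : Q * x * w - y * (M * z) = 1 := by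
    apply mul_left_cancel₀ hQ0; linear_combination hdet
  set A : ℤ := a * x + b * (M * z) with hA
  have hkey : A * (d * (Q * w)) - (a * y + b * (Q * w)) * (d * (M * z)) = (p : ℤ) ^ r := by
    rw [hA]; linear_combination a * d * hdet1 + had
  set g : ℤ := (Int.gcd A (d * (M * z)) : ℤ) with hg
  have hgA : g ∣ A := Int.gcd_dvd_left ..
  have hgz : g ∣ d * (M * z) := Int.gcd_dvd_right ..
  have hgp : g ∣ (p : ℤ) ^ r := by
    rw [← hkey]; exact dvd_sub (hgA.mul_right _) (hgz.mul_left _)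
  have hg0 : 0 < g := by
    rcases (Int.natCast_nonneg (Int.gcd A (d * (M * z)))).lt_or_eq with h | h
    · exact h
    · exfalso; rw [← hg] at h; rw [← h] at hgp; exact hpr.ne' (zero_dvd_iff.1 hgp)
  have hgM : IsCoprime g ((M : ℕ) : ℤ) :=
    ((hcop r).of_isCoprime_of_dvd_left hgp).of_isCoprime_of_dvd_right (Dvd.intro_left _ rfl)
  have hgdz : g ∣ d * z := by
    apply hgM.dvd_of_dvd_mul_left
    rwa [show (M : ℤ) * (d * z) = d * (M * z) by ring]
  obtain ⟨x', hx'⟩ := hgA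
  obtain ⟨z', hz'⟩ := hgdz
  obtain ⟨d', hd'⟩ := hgp
  have hd'0 : 0 < d' := by
    by_contra h
    nlinarith [mul_nonneg hg0.le (by linarith : 0 ≤ -d')]
  have hrel : x' * (d * (Q * w)) - (a * y + b * (Q * w)) * (M * z') = d' := by
    apply mul_left_cancel₀ hg0.ne'
    rw [← hd', ← hkey, hx']
    linear_combination (-(a * y + b * (Q * w)) * M) * (- hz')
  have hu : IsCoprime x' (M * z') := by
    refine ⟨Int.gcdA A (d * (M * z)), Int.gcdB A (d * (M * z)), mul_left_cancel₀ hg0.ne' ?_⟩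
    have hbez : g = _ := Int.gcd_eq_gcd_ab A (d * (M * z))
    linear_combination (-1 : ℤ) * hbez - Int.gcdA A (d * (M * z)) * hx' -
      Int.gcdB A (d * (M * z)) * M * hz'
  obtain ⟨u, v, huv⟩ := hu
  obtain ⟨s, t, hst⟩ : IsCoprime d' (Q : ℤ) :=
    ((hcop r).of_isCoprime_of_dvd_left (Dvd.intro_left g hd'.symm)).of_isCoprime_of_dvd_right
      (Dvd.intro _ rfl)
  set B : ℤ := a * y + b * (Q * w) with hB
  set b0 : ℤ := u * t * B + v * (d * w) with hb0
  have h1 : d' ∣ B - Q * x' * b0 := by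
    refine ⟨u * x' * s * B - v, ?_⟩
    rw [hb0]
    linear_combination (-B) * huv + (-B * u * x') * hst - v * hrel
  have h2 : d' ∣ d * w - M * z' * b0 := by
    have : d' ∣ Q * (d * w - M * z' * b0) := by
      refine ⟨u + u * B * M * z' * s, ?_⟩
      rw [hb0]
      linear_combination (-Q * d * w) * huv + (-B * u * M * z') * hst + u * hrel
    exact (show IsCoprime d' (Q : ℤ) from ⟨s, t, hst⟩).dvd_of_dvd_mul_left this
  obtain ⟨k, hk⟩ : d' ∣ b0 - b0 % d' := Int.dvd_self_sub_emod
  obtain ⟨y', hy'⟩ := h1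
  obtain ⟨w', hw'⟩ := h2
  have e1 : B = Q * x' * (b0 % d') + (y' + Q * x' * k) * d' := by
    linear_combination hy' + Q * x' * hk
  have e2 : d * (Q * w) = Q * M * z' * (b0 % d') + Q * (w' + M * z' * k) * d' := by
    linear_combination Q * hw' + Q * M * z' * hk
  refine ⟨g, b0 % d', d', x', y' + Q * x' * k, z', w' + M * z' * k, hg0,
    Int.emod_nonneg _ hd'0.ne', Int.emod_lt_of_pos _ hd'0, hd'.symm, ?_, ?_, e1, ?_, e2⟩
  · apply mul_left_cancel₀ hd'0.ne'
    linear_combination Q * hrel - Q * x' * e2 + Q * M * z' * e1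
  · linear_combination Q * hx'
  · linear_combination Q * M * hz'

/-- The point `(p ^ i τ + v) / p ^ (r - i)` of the upper half-plane. -/
noncomputable def heckePoint (p r i v : ℕ) (hp : 0 < p) (τ : UpperHalfPlane) : UpperHalfPlane :=
  ⟨((p : ℂ) ^ i * τ + v) / (p : ℂ) ^ (r - i), hecke_im_pos p r i v hp τ⟩

/-- The index set of the sum that defines `T(p ^ r)`. -/
abbrev HeckeIndex (p r : ℕ) : Type := Σ i : Fin (r + 1), Fin (p ^ (r - i))

lemma heckeT_eq_sum (p r : ℕ) (hp : 0 < p) (f : UpperHalfPlane → ℂ) (τ : UpperHalfPlane) :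
    heckeT p r hp f τ = ∑ j : HeckeIndex p r, f (heckePoint p r j.1 j.2 hp τ) := by
  simp [heckeT, Finset.sum_range, Fintype.sum_sigma, heckePoint]

lemma exists_heckeIndex_eq {p r : ℕ} (hp : p.Prime) {a b d : ℤ} (ha : 0 < a) (hb : 0 ≤ b)
    (hbd : b < d) (had : a * d = (p : ℤ) ^ r) :
    ∃ j : HeckeIndex p r, a = (p : ℤ) ^ (j.1 : ℕ) ∧ b = (j.2 : ℕ) ∧
      d = (p : ℤ) ^ (r - (j.1 : ℕ)) := by
  lift a to ℕ using ha.le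
  lift b to ℕ using hb
  lift d to ℕ using by lia
  have had' : a * d = p ^ r := by exact_mod_cast had
  obtain ⟨i, hi, rfl⟩ := (Nat.dvd_prime_pow hp).1 (Dvd.intro _ had')
  have hd : d = p ^ (r - i) := by
    apply Nat.eq_of_mul_eq_mul_left (pow_pos hp.pos i)
    rw [had', ← pow_add, Nat.add_sub_cancel' hi]
  subst hd
  exact ⟨⟨⟨i, by omega⟩, ⟨b, by exact_mod_cast hbd⟩⟩, by simp, by simp, by simp⟩

/-- `exists_upperTri_exchange` for the matrices that define `T(p ^ r)`. -/
lemma exists_heckeIndex_exchange {N Q p r : ℕ} (hQN : Q ∣ N) (hN : 0 < N)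
    (hp : p.Prime) (hpN : ¬ p ∣ N) (j : HeckeIndex p r) {x y z w : ℤ}
    (hdet : (Q * x) * (Q * w) - y * (N * z) = (Q : ℤ)) :
    ∃ (j' : HeckeIndex p r) (x' y' z' w' : ℤ),
      (Q * x') * (Q * w') - y' * (N * z') = (Q : ℤ) ∧
      (p : ℤ) ^ (j.1 : ℕ) * (Q * x) + (j.2 : ℕ) * (N * z) = Q * x' * (p : ℤ) ^ (j'.1 : ℕ) ∧
      (p : ℤ) ^ (j.1 : ℕ) * y + (j.2 : ℕ) * (Q * w) =
        Q * x' * (j'.2 : ℕ) + y' * (p : ℤ) ^ (r - (j'.1 : ℕ)) ∧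
      (p : ℤ) ^ (r - (j.1 : ℕ)) * (N * z) = N * z' * (p : ℤ) ^ (j'.1 : ℕ) ∧
      (p : ℤ) ^ (r - (j.1 : ℕ)) * (Q * w) =
        N * z' * (j'.2 : ℕ) + Q * w' * (p : ℤ) ^ (r - (j'.1 : ℕ)) := by
  have hpos : (0 : ℤ) < (p : ℤ) ^ (j.1 : ℕ) := pow_pos (by exact_mod_cast hp.pos) _
  have hmul : (p : ℤ) ^ (j.1 : ℕ) * (p : ℤ) ^ (r - (j.1 : ℕ)) = (p : ℤ) ^ r := by
    rw [← pow_add, Nat.add_sub_cancel' (Nat.lt_succ_iff.1 j.1.2)]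
  obtain ⟨a', b', d', x', y', z', w', ha', hb', hbd', had', hdet', h1, h2, h3, h4⟩ :=
    exists_upperTri_exchange (b := (j.2 : ℕ)) hQN hN hp hpN hpos hmul hdet
  obtain ⟨j', rfl, rfl, rfl⟩ := exists_heckeIndex_eq hp ha' hb' hbd' had'
  exact ⟨j', x', y', z', w', hdet', h1, h2, h3, h4⟩

lemma intCast_mul_add_ne_zero {c d : ℤ} (h : c ≠ 0 ∨ d ≠ 0) (τ : UpperHalfPlane) :
    (c : ℂ) * τ + d ≠ 0 := by
  have := UpperHalfPlane.linear_ne_zero (cd := ![(c : ℝ), (d : ℝ)]) τ (by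
    intro h0
    have h1 := congrFun h0 0
    have h2 := congrFun h0 1
    simp at h1 h2
    exact h.elim (· h1) (· h2))
  simpa using this

/-- A matrix identity `α M = M' α'` turns into an identity of Möbius transformations. -/
lemma heckePoint_eq_of_exchange {p r : ℕ} (hp : 0 < p) {i v i' v' : ℕ}
    {m₁₁ m₁₂ m₂₁ m₂₂ n₁₁ n₁₂ n₂₁ n₂₂ : ℤ} (hm : m₁₁ * m₂₂ - m₁₂ * m₂₁ ≠ 0)
    (h₁₁ : (p : ℤ) ^ i * m₁₁ + v * m₂₁ = n₁₁ * (p : ℤ) ^ i')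
    (h₁₂ : (p : ℤ) ^ i * m₁₂ + v * m₂₂ = n₁₁ * v' + n₁₂ * (p : ℤ) ^ (r - i'))
    (h₂₁ : (p : ℤ) ^ (r - i) * m₂₁ = n₂₁ * (p : ℤ) ^ i')
    (h₂₂ : (p : ℤ) ^ (r - i) * m₂₂ = n₂₁ * v' + n₂₂ * (p : ℤ) ^ (r - i'))
    {τ τ' : UpperHalfPlane} (hτ : (τ' : ℂ) = ((m₁₁ : ℂ) * τ + m₁₂) / ((m₂₁ : ℂ) * τ + m₂₂)) :
    (heckePoint p r i v hp τ' : ℂ) =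
      ((n₁₁ : ℂ) * heckePoint p r i' v' hp τ + n₁₂) /
        ((n₂₁ : ℂ) * heckePoint p r i' v' hp τ + n₂₂) := by
  have hp0 : (p : ℂ) ≠ 0 := by exact_mod_cast hp.ne'
  have hden : (m₂₁ : ℂ) * τ + m₂₂ ≠ 0 := by
    apply intCast_mul_add_ne_zero
    by_contra! h
    simp [h.1, h.2] at hm
  have e₁₁ : (p : ℂ) ^ i * m₁₁ + v * m₂₁ = n₁₁ * (p : ℂ) ^ i' := by exact_mod_cast h₁₁
  have e₁₂ : (p : ℂ) ^ i * m₁₂ + v * m₂₂ = n₁₁ * v' + n₁₂ * (p : ℂ) ^ (r - i') := by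
    exact_mod_cast h₁₂
  have e₂₁ : (p : ℂ) ^ (r - i) * m₂₁ = n₂₁ * (p : ℂ) ^ i' := by exact_mod_cast h₂₁
  have e₂₂ : (p : ℂ) ^ (r - i) * m₂₂ = n₂₁ * v' + n₂₂ * (p : ℂ) ^ (r - i') := by
    exact_mod_cast h₂₂
  have hd : (p : ℂ) ^ (r - i) ≠ 0 := pow_ne_zero _ hp0
  have hd' : (p : ℂ) ^ (r - i') ≠ 0 := pow_ne_zero _ hp0
  have hnum : (n₁₁ : ℂ) * heckePoint p r i' v' hp τ + n₁₂ =
      ((p : ℂ) ^ i * (m₁₁ * τ + m₁₂) + v * (m₂₁ * τ + m₂₂)) / (p : ℂ) ^ (r - i') := by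
    simp only [heckePoint]
    rw [eq_div_iff hd', add_mul, mul_assoc, div_mul_cancel₀ _ hd']
    linear_combination (-(τ : ℂ)) * e₁₁ - e₁₂
  have hdn : (n₂₁ : ℂ) * heckePoint p r i' v' hp τ + n₂₂ =
      ((p : ℂ) ^ (r - i) * (m₂₁ * τ + m₂₂)) / (p : ℂ) ^ (r - i') := by
    simp only [heckePoint]
    rw [eq_div_iff hd', add_mul, mul_assoc, div_mul_cancel₀ _ hd']
    linear_combination (-(τ : ℂ)) * e₂₁ - e₂₂
  rw [hnum, hdn, div_div_div_cancel_right₀ hd']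
  have hcancel := div_mul_cancel₀ ((m₁₁ : ℂ) * τ + m₁₂) hden
  simp only [heckePoint]
  rw [hτ, div_eq_div_iff hd (mul_ne_zero hd hden)]
  linear_combination ((p : ℂ) ^ i * (p : ℂ) ^ (r - i)) * hcancel

/-- Distinct matrices that define `T(p ^ r)` lie in distinct left cosets. -/
lemma heckeIndex_eq_of_exchange {N Q p r : ℕ} (hQN : Q ∣ N) (hQ : 0 < Q)
    (hp : p.Prime)
    {j₁ j₂ j' : HeckeIndex p r} {x y z w x₁ y₁ z₁ w₁ x₂ y₂ z₂ w₂ : ℤ}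
    (hdet : (Q * x) * (Q * w) - y * (N * z) = (Q : ℤ))
    (h₁ : (p : ℤ) ^ (j₁.1 : ℕ) * (Q * x) + (j₁.2 : ℕ) * (N * z) = Q * x₁ * (p : ℤ) ^ (j'.1 : ℕ) ∧
      (p : ℤ) ^ (j₁.1 : ℕ) * y + (j₁.2 : ℕ) * (Q * w) =
        Q * x₁ * (j'.2 : ℕ) + y₁ * (p : ℤ) ^ (r - (j'.1 : ℕ)) ∧
      (p : ℤ) ^ (r - (j₁.1 : ℕ)) * (N * z) = N * z₁ * (p : ℤ) ^ (j'.1 : ℕ) ∧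
      (p : ℤ) ^ (r - (j₁.1 : ℕ)) * (Q * w) =
        N * z₁ * (j'.2 : ℕ) + Q * w₁ * (p : ℤ) ^ (r - (j'.1 : ℕ)))
    (h₂ : (p : ℤ) ^ (j₂.1 : ℕ) * (Q * x) + (j₂.2 : ℕ) * (N * z) = Q * x₂ * (p : ℤ) ^ (j'.1 : ℕ) ∧
      (p : ℤ) ^ (j₂.1 : ℕ) * y + (j₂.2 : ℕ) * (Q * w) =
        Q * x₂ * (j'.2 : ℕ) + y₂ * (p : ℤ) ^ (r - (j'.1 : ℕ)) ∧
      (p : ℤ) ^ (r - (j₂.1 : ℕ)) * (N * z) = N * z₂ * (p : ℤ) ^ (j'.1 : ℕ) ∧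
      (p : ℤ) ^ (r - (j₂.1 : ℕ)) * (Q * w) =
        N * z₂ * (j'.2 : ℕ) + Q * w₂ * (p : ℤ) ^ (r - (j'.1 : ℕ))) :
    j₁ = j₂ := by
  obtain ⟨M, rfl⟩ := hQN
  have hQ0 : (Q : ℤ) ≠ 0 := by exact_mod_cast hQ.ne'
  have hmul : ∀ j : HeckeIndex p r,
      (p : ℤ) ^ (j.1 : ℕ) * (p : ℤ) ^ (r - (j.1 : ℕ)) = (p : ℤ) ^ r := fun j => by
    rw [← pow_add, Nat.add_sub_cancel' (Nat.lt_succ_iff.1 j.1.2)]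
  have hpos : ∀ k : ℕ, (0 : ℤ) < (p : ℤ) ^ k := pow_pos (by exact_mod_cast hp.pos)
  have m₁ := hmul j₁
  have m₂ := hmul j₂
  have m' := hmul j'
  have pa₁ := hpos j₁.1
  have pa₂ := hpos j₂.1
  have pd₁ := hpos (r - j₁.1)
  have pd₂ := hpos (r - j₂.1)
  have hb₁ : ((j₁.2 : ℕ) : ℤ) < (p : ℤ) ^ (r - (j₁.1 : ℕ)) := by exact_mod_cast j₁.2.2
  have hb₂ : ((j₂.2 : ℕ) : ℤ) < (p : ℤ) ^ (r - (j₂.1 : ℕ)) := by exact_mod_cast j₂.2.2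
  obtain ⟨k₁, l₁, n₁, o₁⟩ := h₁
  obtain ⟨k₂, l₂, n₂, o₂⟩ := h₂
  suffices h : (p : ℤ) ^ (j₁.1 : ℕ) = (p : ℤ) ^ (j₂.1 : ℕ) ∧
      (p : ℤ) ^ (r - (j₁.1 : ℕ)) = (p : ℤ) ^ (r - (j₂.1 : ℕ)) ∧
      ((j₁.2 : ℕ) : ℤ) = (j₂.2 : ℕ) by
    obtain ⟨⟨i₁, hi₁⟩, ⟨v₁, hv₁⟩⟩ := j₁
    obtain ⟨⟨i₂, hi₂⟩, ⟨v₂, hv₂⟩⟩ := j₂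
    obtain ⟨ha, -, hb⟩ := h
    obtain rfl : i₁ = i₂ := Nat.pow_right_injective hp.two_le (by exact_mod_cast ha)
    obtain rfl : v₁ = v₂ := by exact_mod_cast hb
    rfl
  generalize (p : ℤ) ^ (j₁.1 : ℕ) = a₁ at *
  generalize (p : ℤ) ^ (j₂.1 : ℕ) = a₂ at *
  generalize (p : ℤ) ^ (j'.1 : ℕ) = a' at *
  generalize (p : ℤ) ^ (r - (j₁.1 : ℕ)) = d₁ at *
  generalize (p : ℤ) ^ (r - (j₂.1 : ℕ)) = d₂ at *
  generalize (p : ℤ) ^ (r - (j'.1 : ℕ)) = d' at *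
  have b₁0 : (0 : ℤ) ≤ (j₁.2 : ℕ) := by positivity
  have b₂0 : (0 : ℤ) ≤ (j₂.2 : ℕ) := by positivity
  generalize ((j₁.2 : ℕ) : ℤ) = b₁ at *
  generalize ((j₂.2 : ℕ) : ℤ) = b₂ at *
  generalize ((j'.2 : ℕ) : ℤ) = b' at *
  push_cast at *
  have e₁₁ : a₁ * d₂ = a' * d' * (Q * x₁ * w₂ - y₁ * M * z₂) := by
    apply mul_left_cancel₀ hQ0
    linear_combination (-(a₁ * d₂)) * hdet + d₂ * (Q * w) * k₁ + Q * x₁ * a' * o₂ -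
      d₂ * (Q * M * z) * l₁ - (Q * x₁ * b' + y₁ * d') * n₂
  have e₂₂ : d₁ * a₂ = a' * d' * (Q * w₁ * x₂ - M * z₁ * y₂) := by
    apply mul_left_cancel₀ hQ0
    linear_combination (-(a₂ * d₁)) * hdet + d₁ * (Q * w) * k₂ + Q * x₂ * a' * o₁ -
      d₁ * (Q * M * z) * l₂ - (Q * x₂ * b' + y₂ * d') * n₁
  have e₁₂ : b₁ * a₂ - a₁ * b₂ = a' * d' * (y₁ * x₂ - x₁ * y₂) := by
    apply mul_left_cancel₀ hQ0
    linear_combination (-(b₁ * a₂ - a₁ * b₂)) * hdet + (a₂ * y + b₂ * (Q * w)) * (-k₁) -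
      Q * x₁ * a' * l₂ + (a₂ * (Q * x) + b₂ * (Q * M * z)) * l₁ +
      (Q * x₁ * b' + y₁ * d') * k₂
  have ha₂₁ : a₂ ∣ a₁ := ⟨Q * x₁ * w₂ - y₁ * M * z₂, mul_left_cancel₀ pd₂.ne' (by
    linear_combination e₁₁ + (Q * x₁ * w₂ - y₁ * M * z₂) * (m' - m₂))⟩
  have ha₁₂ : a₁ ∣ a₂ := ⟨Q * w₁ * x₂ - M * z₁ * y₂, mul_left_cancel₀ pd₁.ne' (by
    linear_combination e₂₂ + (Q * w₁ * x₂ - M * z₁ * y₂) * (m' - m₁))⟩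
  obtain rfl : a₁ = a₂ := Int.dvd_antisymm pa₁.le pa₂.le ha₁₂ ha₂₁
  obtain rfl : d₁ = d₂ := mul_left_cancel₀ pa₁.ne' (m₁.trans m₂.symm)
  have hdvd : d₁ ∣ b₁ - b₂ := ⟨y₁ * x₂ - x₁ * y₂, mul_left_cancel₀ pa₁.ne' (by
    linear_combination e₁₂ + (y₁ * x₂ - x₁ * y₂) * (m' - m₁))⟩
  refine ⟨rfl, rfl, ?_⟩
  have := Int.eq_zero_of_abs_lt_dvd hdvd (by rw [abs_lt]; constructor <;> linarith)
  linarith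

/-- `T(p ^ r)` preserves invariance under the Atkin–Lehner type matrices of determinant `Q`. -/
lemma moebInv_heckeT {N Q p r : ℕ} (hQN : Q ∣ N) (hN : 0 < N) (hp : p.Prime) (hpN : ¬ p ∣ N)
    {f : UpperHalfPlane → ℂ}
    (hf : ∀ x y z w : ℤ, (Q * x) * (Q * w) - y * (N * z) = (Q : ℤ) →
      MoebInv !![(Q : ℤ) * x, y; (N : ℤ) * z, (Q : ℤ) * w] f)
    {x y z w : ℤ} (hdet : (Q * x) * (Q * w) - y * (N * z) = (Q : ℤ)) :
    MoebInv !![(Q : ℤ) * x, y; (N : ℤ) * z, (Q : ℤ) * w] (heckeT p r hp.pos f) := by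
  have hQ : 0 < Q := Nat.pos_of_dvd_of_pos hQN hN
  intro τ τ' hτ
  rw [heckeT_eq_sum, heckeT_eq_sum]
  choose φ x' y' z' w' hdet' hφ using fun j : HeckeIndex p r =>
    exists_heckeIndex_exchange hQN hN hp hpN j hdet
  have hinj : Function.Injective φ := fun j₁ j₂ h =>
    heckeIndex_eq_of_exchange hQN hQ hp hdet (hφ j₁) (h ▸ hφ j₂)
  rw [← (Finite.injective_iff_bijective.1 hinj).sum_comp
    fun j => f (heckePoint p r j.1 j.2 hp.pos τ)]
  refine Finset.sum_congr rfl fun j _ => ?_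
  refine hf _ _ _ _ (hdet' j) _ _ ?_
  obtain ⟨h₁₁, h₁₂, h₂₁, h₂₂⟩ := hφ j
  exact heckePoint_eq_of_exchange hp.pos (by rw [hdet]; exact_mod_cast hQ.ne') h₁₁ h₁₂ h₂₁ h₂₂ hτ

lemma holoOnH_heckeT {p r : ℕ} (hp : 0 < p) {f : UpperHalfPlane → ℂ} (hf : HoloOnH f) :
    HoloOnH (heckeT p r hp f) := by
  obtain ⟨F, hF, hfF⟩ := hf
  refine ⟨fun z => ∑ i ∈ Finset.range (r + 1), ∑ v ∈ Finset.range (p ^ (r - i)),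
    F (((p : ℂ) ^ i * z + v) / (p : ℂ) ^ (r - i)), ?_, fun τ => ?_⟩
  · refine DifferentiableOn.fun_sum fun i _ => DifferentiableOn.fun_sum fun v _ => ?_
    refine hF.comp (by fun_prop) fun z hz => ?_
    exact hecke_im_pos p r i v hp ⟨z, hz⟩
  · simp only [heckeT, hfF]

lemma sum_exp_eq_ite {d : ℕ} (hd : 0 < d) (n : ℤ) :
    ∑ v ∈ Finset.range d, Complex.exp (2 * Real.pi * Complex.I * n / d) ^ v =
      if (d : ℤ) ∣ n then (d : ℂ) else 0 := by
  have hd0 : (d : ℂ) ≠ 0 := by exact_mod_cast hd.ne'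
  split_ifs with h
  · obtain ⟨k, rfl⟩ := h
    have : Complex.exp (2 * Real.pi * Complex.I * ((d * k : ℤ) : ℂ) / d) = 1 := by
      rw [Complex.exp_eq_one_iff]
      refine ⟨k, ?_⟩
      push_cast
      field_simp
    simp only [this, one_pow]
    simp
  · have h1 : Complex.exp (2 * Real.pi * Complex.I * n / d) ≠ 1 := by
      rw [Ne, Complex.exp_eq_one_iff]
      rintro ⟨k, hk⟩
      refine h ⟨k, ?_⟩
      have hpi := Complex.two_pi_I_ne_zero
      rw [div_eq_iff hd0] at hk
      have : (n : ℂ) = d * k := mul_left_cancel₀ hpi (by linear_combination hk)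
      exact_mod_cast this
    have hpow : Complex.exp (2 * Real.pi * Complex.I * n / d) ^ d = 1 := by
      rw [← Complex.exp_nat_mul, Complex.exp_eq_one_iff]
      exact ⟨n, by field_simp⟩
    rw [geom_sum_eq h1, hpow, sub_self, zero_div]

/-- The `q`-expansion of `∑ v ∈ range d, f ((a τ + v) / d)`. -/
lemma hasSum_sum_upperTri {f : UpperHalfPlane → ℂ} {c : ℤ → ℂ}
    (hf : ∀ τ, HasSum (fun n : ℤ => c n * qexp τ ^ n) (f τ)) {a d : ℕ} (ha : 0 < a) (hd : 0 < d)
    (τ : UpperHalfPlane) (g : ℕ → UpperHalfPlane)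
    (hg : ∀ v, (g v : ℂ) = ((a : ℂ) * τ + v) / d) :
    HasSum (fun n : ℤ => (if (a : ℤ) ∣ n then (d : ℂ) * c (d * (n / a)) else 0) * qexp τ ^ n)
      (∑ v ∈ Finset.range d, f (g v)) := by
  have hd0 : (d : ℂ) ≠ 0 := by exact_mod_cast hd.ne'
  have ha0 : (a : ℤ) ≠ 0 := by exact_mod_cast ha.ne'
  have hdz : (d : ℤ) ≠ 0 := by exact_mod_cast hd.ne'
  have hterm : ∀ n : ℤ, ∑ v ∈ Finset.range d, c n * qexp (g v) ^ n =
      c n * Complex.exp (2 * Real.pi * Complex.I * n * (a * τ) / d) *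
        if (d : ℤ) ∣ n then (d : ℂ) else 0 := by
    intro n
    rw [← sum_exp_eq_ite hd, Finset.mul_sum]
    refine Finset.sum_congr rfl fun v _ => ?_
    rw [mul_assoc, qexp, hg, ← Complex.exp_int_mul, ← Complex.exp_nat_mul, ← Complex.exp_add]
    congr 2
    ring
  have hsum := hasSum_sum (s := Finset.range d) fun v _ => hf (g v)
  simp only [hterm] at hsum
  rw [← (mul_right_injective₀ hdz).hasSum_iff (fun n hn => by
    rw [if_neg fun ⟨k, hk⟩ => hn ⟨k, hk.symm⟩, mul_zero])] at hsum
  rw [← (mul_right_injective₀ ha0).hasSum_iff (fun n hn => by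
    rw [if_neg fun ⟨k, hk⟩ => hn ⟨k, hk.symm⟩, zero_mul])]
  convert hsum using 1
  funext k
  simp only [Function.comp_apply, dvd_mul_right, if_true, Int.mul_ediv_cancel_left _ ha0]
  rw [qexp, ← Complex.exp_int_mul, mul_comm (d : ℂ), mul_right_comm]
  congr 3
  push_cast
  field_simp

lemma exists_hasSum_heckeT {p r : ℕ} (hp : 0 < p) {f : UpperHalfPlane → ℂ}
    (hf : ∃ m : ℕ, ∃ c : ℤ → ℂ, (∀ n : ℤ, n < -(m : ℤ) → c n = 0) ∧
      ∀ τ : UpperHalfPlane, HasSum (fun n : ℤ => c n * qexp τ ^ n) (f τ)) :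
    ∃ m : ℕ, ∃ c : ℤ → ℂ, (∀ n : ℤ, n < -(m : ℤ) → c n = 0) ∧
      ∀ τ : UpperHalfPlane, HasSum (fun n : ℤ => c n * qexp τ ^ n) (heckeT p r hp f τ) := by
  obtain ⟨m, c, hc, hf⟩ := hf
  refine ⟨p ^ r * m, fun n => ∑ i ∈ Finset.range (r + 1),
    if ((p ^ i : ℕ) : ℤ) ∣ n then ((p ^ (r - i) : ℕ) : ℂ) *
      c ((p ^ (r - i) : ℕ) * (n / (p ^ i : ℕ))) else 0, fun n hn => ?_, fun τ => ?_⟩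
  · refine Finset.sum_eq_zero fun i hi => ?_
    split_ifs with h
    · obtain ⟨k, rfl⟩ := h
      have ha : 0 < p ^ i := pow_pos hp i
      have hd : 0 < p ^ (r - i) := pow_pos hp _
      have har : p ^ i ≤ p ^ r := Nat.pow_le_pow_right hp (by simp at hi; omega)
      have ha' : ((p ^ i : ℕ) : ℤ) ≠ 0 := by exact_mod_cast ha.ne'
      rw [Int.mul_ediv_cancel_left _ ha', hc, mul_zero]
      rw [Nat.cast_mul] at hn
      generalize p ^ i = a at *
      generalize p ^ (r - i) = d at *
      generalize p ^ r = P at *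
      zify at ha hd har
      have hm : (0 : ℤ) ≤ m := by positivity
      have hk : k < -m := by
        by_contra! hk
        nlinarith [mul_le_mul_of_nonneg_right har hm]
      nlinarith
    · rfl
  · simp only [Finset.sum_mul, heckeT]
    refine hasSum_sum fun i _ => ?_
    exact hasSum_sum_upperTri hf (pow_pos hp i) (pow_pos hp _) τ
      (fun v => heckePoint p r i v hp τ) (fun v => by simp [heckePoint])

/-- The projective class of the vector `v` is `Γ`-equivalent to the cusp `i∞`. -/
def VecEquivInf (N : ℕ) (S : Finset ℕ) (v : Fin 2 → ℚ) : Prop :=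
  ∃ g ∈ GammaGrp N S, ∃ k : ℚ, k ≠ 0 ∧ (g : Matrix (Fin 2) (Fin 2) ℚ) *ᵥ ![1, 0] = k • v

lemma VecEquivInf.of_smul {N : ℕ} {S : Finset ℕ} {v : Fin 2 → ℚ} {k : ℚ} (hk : k ≠ 0)
    (h : VecEquivInf N S (k • v)) : VecEquivInf N S v := by
  obtain ⟨g, hg, l, hl, h⟩ := h
  exact ⟨g, hg, l * k, mul_ne_zero hl hk, by rw [h, smul_smul]⟩

lemma VecEquivInf.smul {N : ℕ} {S : Finset ℕ} {v : Fin 2 → ℚ} {k : ℚ} (hk : k ≠ 0)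
    (h : VecEquivInf N S v) : VecEquivInf N S (k • v) :=
  .of_smul (inv_ne_zero hk) (by rwa [smul_smul, inv_mul_cancel₀ hk, one_smul])

lemma VecEquivInf.mulVec {N : ℕ} {S : Finset ℕ} {v : Fin 2 → ℚ} {g : GL (Fin 2) ℚ}
    (hg : g ∈ GammaGrp N S) (h : VecEquivInf N S v) :
    VecEquivInf N S ((g : Matrix (Fin 2) (Fin 2) ℚ) *ᵥ v) := by
  obtain ⟨g', hg', l, hl, h⟩ := h
  refine ⟨g * g', mul_mem hg hg', l, hl, ?_⟩
  rw [Units.val_mul, ← Matrix.mulVec_mulVec, h, Matrix.mulVec_smul]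

/-- The Atkin–Lehner type matrix `!![Q x, y; N z, Q w]` over `ℚ`. -/
def atkinLehnerMatrix (N Q : ℕ) (x y z w : ℤ) : Matrix (Fin 2) (Fin 2) ℚ :=
  !![(Q : ℚ) * x, (y : ℚ); (N : ℚ) * z, (Q : ℚ) * w]

lemma exists_atkinLehnerMatrix_of_mem_gammaGens {N : ℕ} {S : Finset ℕ} {g : GL (Fin 2) ℚ}
    (hg : g ∈ GammaGens N S) :
    ∃ Q : ℕ, (Q = 1 ∨ Q ∈ S) ∧ ∃ x y z w : ℤ,
      (Q * x) * (Q * w) - y * (N * z) = (Q : ℤ) ∧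
      (g : Matrix (Fin 2) (Fin 2) ℚ) = atkinLehnerMatrix N Q x y z w := by
  rcases hg with ⟨a, b, c, d, hdet, ⟨z, rfl⟩, hg⟩ | ⟨Q, hQ, x, y, z, w, hg, hdet⟩
  · refine ⟨1, Or.inl rfl, a, b, z, d, ?_, ?_⟩
    · push_cast
      linear_combination hdet
    · rw [hg, atkinLehnerMatrix]
      simp
  · refine ⟨Q, Or.inr hQ, x, y, z, w, ?_, hg⟩
    rw [hg, Matrix.det_fin_two_of] at hdet
    exact_mod_cast hdet

lemma VecEquivInf.atkinLehnerMatrix_mulVec {N : ℕ} {S : Finset ℕ} {v : Fin 2 → ℚ} {Q : ℕ}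
    (hQ0 : 0 < Q) (hQ : Q = 1 ∨ Q ∈ S) {x y z w : ℤ}
    (hdet : (Q * x) * (Q * w) - y * (N * z) = (Q : ℤ)) (h : VecEquivInf N S v) :
    VecEquivInf N S (atkinLehnerMatrix N Q x y z w *ᵥ v) := by
  have hdetQ : (atkinLehnerMatrix N Q x y z w).det = (Q : ℚ) := by
    rw [atkinLehnerMatrix, Matrix.det_fin_two_of]
    exact_mod_cast hdet
  let g : GL (Fin 2) ℚ := Matrix.GeneralLinearGroup.mkOfDetNeZero (atkinLehnerMatrix N Q x y z w)
    (by rw [hdetQ]; exact_mod_cast hQ0.ne')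
  refine VecEquivInf.mulVec (g := g) (Subgroup.subset_closure ?_) h
  rcases hQ with rfl | hQ
  · refine Or.inl ⟨x, y, N * z, w, by push_cast at hdet; linear_combination hdet,
      dvd_mul_right _ _, ?_⟩
    change atkinLehnerMatrix N 1 x y z w = _
    simp [atkinLehnerMatrix]
  · exact Or.inr ⟨Q, hQ, x, y, z, w, rfl, hdetQ⟩

/-- If all upper triangular matrices of determinant `p ^ r` send `v` into the `Γ`-orbit of the cusp
`i∞`, then they do the same for the image of `v` under an Atkin–Lehner matrix. -/
lemma vecEquivInf_upperTri_atkinLehnerMatrix {N Q p r : ℕ} {S : Finset ℕ} (hQN : Q ∣ N)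
    (hN : 0 < N) (hQ : Q = 1 ∨ Q ∈ S) (hp : p.Prime) (hpN : ¬ p ∣ N) {x y z w : ℤ}
    (hdet : (Q * x) * (Q * w) - y * (N * z) = (Q : ℤ)) {v : Fin 2 → ℚ}
    (hv : ∀ a b d : ℤ, 0 < a → a * d = (p : ℤ) ^ r →
      VecEquivInf N S (!![(a : ℚ), (b : ℚ); 0, (d : ℚ)] *ᵥ v))
    {a b d : ℤ} (ha : 0 < a) (had : a * d = (p : ℤ) ^ r) :
    VecEquivInf N S
      (!![(a : ℚ), (b : ℚ); 0, (d : ℚ)] *ᵥ (atkinLehnerMatrix N Q x y z w *ᵥ v)) := by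
  obtain ⟨a', b', d', x', y', z', w', ha', -, -, had', hdet', h1, h2, h3, h4⟩ :=
    exists_upperTri_exchange (b := b) hQN hN hp hpN ha had hdet
  have hmat : !![(a : ℚ), (b : ℚ); 0, (d : ℚ)] * atkinLehnerMatrix N Q x y z w =
      atkinLehnerMatrix N Q x' y' z' w' * !![(a' : ℚ), (b' : ℚ); 0, (d' : ℚ)] := by
    have e1 : (a * (Q * x) + b * (N * z) : ℚ) = Q * x' * a' := by exact_mod_cast h1
    have e2 : (a * y + b * (Q * w) : ℚ) = Q * x' * b' + y' * d' := by exact_mod_cast h2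
    have e3 : (d * (N * z) : ℚ) = N * z' * a' := by exact_mod_cast h3
    have e4 : (d * (Q * w) : ℚ) = N * z' * b' + Q * w' * d' := by exact_mod_cast h4
    simp [atkinLehnerMatrix, e1, e2, e3, e4]
  rw [Matrix.mulVec_mulVec, hmat, ← Matrix.mulVec_mulVec]
  exact (hv a' b' d' ha' had').atkinLehnerMatrix_mulVec (Nat.pos_of_dvd_of_pos hQN hN) hQ hdet'

/-- Upper triangular matrices of determinant `p ^ r` preserve the `Γ`-orbit of the cusp `i∞`. -/
lemma vecEquivInf_upperTri_mulVec {N p r : ℕ} {S : Finset ℕ} (hN : 0 < N)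
    (hS : ∀ Q ∈ S, Q ∣ N) (hp : p.Prime) (hpN : ¬ p ∣ N) {g : GL (Fin 2) ℚ}
    (hg : g ∈ GammaGrp N S) {a b d : ℤ} (ha : 0 < a) (had : a * d = (p : ℤ) ^ r) :
    VecEquivInf N S (!![(a : ℚ), (b : ℚ); 0, (d : ℚ)] *ᵥ
      ((g : Matrix (Fin 2) (Fin 2) ℚ) *ᵥ ![1, 0])) := by
  have hdvd : ∀ Q : ℕ, (Q = 1 ∨ Q ∈ S) → Q ∣ N := by
    rintro Q (rfl | hQ)
    exacts [one_dvd N, hS Q hQ]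
  induction hg using Subgroup.closure_induction_left generalizing a b d with
  | one =>
    have ha0 : (a : ℚ) ≠ 0 := by exact_mod_cast ha.ne'
    refine ⟨1, one_mem _, (a : ℚ)⁻¹, inv_ne_zero ha0, ?_⟩
    ext i
    fin_cases i <;> simp [Matrix.mulVec, dotProduct, Fin.sum_univ_two, ha0]
  | mul_left s hs y hy ih =>
    obtain ⟨Q, hQ, x, y', z, w, hdet, hs'⟩ := exists_atkinLehnerMatrix_of_mem_gammaGens hs
    rw [Units.val_mul, ← Matrix.mulVec_mulVec, hs']
    exact vecEquivInf_upperTri_atkinLehnerMatrix (hdvd Q hQ) hN hQ hp hpN hdet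
      (fun a b d ha had => ih ha had) ha had
  | inv_mul_cancel s hs y hy ih =>
    obtain ⟨Q, hQ, x, y', z, w, hdet, hs'⟩ := exists_atkinLehnerMatrix_of_mem_gammaGens hs
    have hQ0 : (Q : ℚ) ≠ 0 := by
      exact_mod_cast (Nat.pos_of_dvd_of_pos (hdvd Q hQ) hN).ne'
    have hinv : atkinLehnerMatrix N Q w (-y') (-z) x =
        (Q : ℚ) • ((s⁻¹ : GL (Fin 2) ℚ) : Matrix (Fin 2) (Fin 2) ℚ) := by
      have hdet' : ((Q * x) * (Q * w) - y' * (N * z) : ℚ) = Q := by exact_mod_cast hdet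
      rw [Matrix.coe_units_inv, Matrix.inv_def, hs', atkinLehnerMatrix, atkinLehnerMatrix,
        Matrix.adjugate_fin_two_of, Matrix.det_fin_two_of, hdet', Ring.inverse_eq_inv', smul_smul,
        mul_inv_cancel₀ hQ0, one_smul]
      simp
    have := vecEquivInf_upperTri_atkinLehnerMatrix (x := w) (y := -y') (z := -z) (w := x)
      (hdvd Q hQ) hN hQ hp hpN (by linear_combination hdet) (fun a b d ha had => ih ha had)
      (b := b) ha had
    rw [hinv, Matrix.smul_mulVec, Matrix.mulVec_smul] at this
    rw [Units.val_mul, ← Matrix.mulVec_mulVec]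
    exact this.of_smul hQ0

/-- Matrices that define `T(p ^ r)` preserve the set of cusps that are not equivalent to `i∞`. -/
lemma not_cuspEquivInf_of_exchange {N p r : ℕ} {S : Finset ℕ} (hN : 0 < N)
    (hS : ∀ Q ∈ S, Q ∣ N) (hp : p.Prime) (hpN : ¬ p ∣ N) {a b d a' d' σa σc x z : ℤ}
    (ha : 0 < a) (had : a * d = (p : ℤ) ^ r) (had' : a' * d' = (p : ℤ) ^ r)
    (h₁ : a * σa + b * σc = x * a') (h₂ : d * σc = z * a') (h : ¬ CuspEquivInf N S σa σc) :
    ¬ CuspEquivInf N S x z := by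
  rintro ⟨g, hg, k, hk, hgk⟩
  have hP : (p : ℤ) ^ r ≠ 0 := pow_ne_zero _ (by exact_mod_cast hp.ne_zero)
  have ha' : a' ≠ 0 := by rintro rfl; simp at had'; exact hP had'.symm
  have hd' : d' ≠ 0 := by rintro rfl; simp at had'; exact hP had'.symm
  have hd : 0 < d := by
    have : (0 : ℤ) < (p : ℤ) ^ r := pow_pos (by exact_mod_cast hp.pos) r
    rw [← had] at this
    exact pos_of_mul_pos_right this ha.le
  have key := vecEquivInf_upperTri_mulVec (b := -b) hN hS hp hpN hg hd ((mul_comm d a).trans had)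
  have e₁ : d * x - b * z = d' * σa := mul_left_cancel₀ ha' (by
    linear_combination (-d) * h₁ + b * h₂ + σa * (had - had'))
  have e₂ : a * z = d' * σc := mul_left_cancel₀ ha' (by
    linear_combination (-a) * h₂ + σc * (had - had'))
  rw [hgk, Matrix.mulVec_smul] at key
  have hvec : !![(d : ℚ), ((-b : ℤ) : ℚ); 0, (a : ℚ)] *ᵥ ![(x : ℚ), (z : ℚ)] =
      (d' : ℚ) • ![(σa : ℚ), (σc : ℚ)] := by
    have e₁' : (d * x - b * z : ℚ) = d' * σa := by exact_mod_cast e₁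
    have e₂' : (a * z : ℚ) = d' * σc := by exact_mod_cast e₂
    ext i
    fin_cases i
    · simp [Matrix.mulVec, dotProduct, Fin.sum_univ_two]
      linear_combination e₁'
    · simp [Matrix.mulVec, dotProduct, Fin.sum_univ_two, e₂']
  rw [hvec] at key
  exact h ((key.of_smul hk).of_smul (by exact_mod_cast hd'))

lemma im_heckePoint (p r i v : ℕ) (hp : 0 < p) (τ : UpperHalfPlane) :
    (heckePoint p r i v hp τ).im = (p : ℝ) ^ i * τ.im / (p : ℝ) ^ (r - i) := by
  have h : (heckePoint p r i v hp τ : ℂ) =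
      (((p : ℝ) ^ i / (p : ℝ) ^ (r - i) : ℝ) : ℂ) * τ + (((v : ℝ) / (p : ℝ) ^ (r - i) : ℝ) : ℂ) := by
    simp only [heckePoint]
    push_cast
    ring
  rw [← UpperHalfPlane.coe_im, h, Complex.add_im, Complex.im_ofReal_mul, Complex.ofReal_im,
    UpperHalfPlane.coe_im]
  ring

lemma im_div_le_im_heckePoint {p r i v : ℕ} (hp : 0 < p) (τ : UpperHalfPlane) :
    τ.im / (p : ℝ) ^ r ≤ (heckePoint p r i v hp τ).im := by
  have hp1 : (1 : ℝ) ≤ p := by exact_mod_cast hp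
  have h1 : (1 : ℝ) ≤ (p : ℝ) ^ i := one_le_pow₀ hp1
  have h2 : (p : ℝ) ^ (r - i) ≤ (p : ℝ) ^ r := pow_le_pow_right₀ hp1 (Nat.sub_le _ _)
  have hτ := τ.im_pos
  rw [im_heckePoint]
  gcongr
  nlinarith

/-- `T(p ^ r)` preserves boundedness at the cusps that are not equivalent to `i∞`. -/
lemma bounded_heckeT {N p r : ℕ} {S : Finset ℕ} (hN : 0 < N)
    (hS : ∀ Q ∈ S, Q ∣ N) (hp : p.Prime) (hpN : ¬ p ∣ N) {f : UpperHalfPlane → ℂ}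
    (hf : ∀ σa σb σc σd : ℤ, σa * σd - σb * σc = 1 → ¬ CuspEquivInf N S σa σc →
      ∃ C A : ℝ, ∀ τ τ' : UpperHalfPlane, A ≤ τ.im →
        (τ' : ℂ) = ((σa : ℂ) * τ + σb) / ((σc : ℂ) * τ + σd) → ‖f τ'‖ ≤ C)
    {σa σb σc σd : ℤ} (hdet : σa * σd - σb * σc = 1) (hσ : ¬ CuspEquivInf N S σa σc) :
    ∃ C A : ℝ, ∀ τ τ' : UpperHalfPlane, A ≤ τ.im →
      (τ' : ℂ) = ((σa : ℂ) * τ + σb) / ((σc : ℂ) * τ + σd) → ‖heckeT p r hp.pos f τ'‖ ≤ C := by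
  have hpos : (0 : ℝ) < (p : ℝ) ^ r := pow_pos (by exact_mod_cast hp.pos) r
  have hmul : ∀ j : HeckeIndex p r,
      (p : ℤ) ^ (j.1 : ℕ) * (p : ℤ) ^ (r - (j.1 : ℕ)) = (p : ℤ) ^ r := fun j => by
    rw [← pow_add, Nat.add_sub_cancel' (Nat.lt_succ_iff.1 j.1.2)]
  have hterm : ∀ j : HeckeIndex p r, ∃ C A : ℝ, ∀ τ τ' : UpperHalfPlane, A ≤ τ.im →
      (τ' : ℂ) = ((σa : ℂ) * τ + σb) / ((σc : ℂ) * τ + σd) →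
        ‖f (heckePoint p r j.1 j.2 hp.pos τ')‖ ≤ C := by
    intro j
    obtain ⟨j', x', y', z', w', hdet', h₁₁, h₁₂, h₂₁, h₂₂⟩ :=
      exists_heckeIndex_exchange (x := σa) (y := σb) (z := σc) (w := σd) (one_dvd 1) one_pos hp
        hp.not_dvd_one j (by push_cast; linear_combination hdet)
    simp only [Nat.cast_one, one_mul] at hdet' h₁₁ h₁₂ h₂₁ h₂₂
    obtain ⟨C, A, hCA⟩ := hf x' y' z' w' (by linear_combination hdet')
      (not_cuspEquivInf_of_exchange hN hS hp hpN (pow_pos (by exact_mod_cast hp.pos) _) (hmul j)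
        (hmul j') h₁₁ h₂₁ hσ)
    refine ⟨C, A * (p : ℝ) ^ r, fun τ τ' hτ hmap =>
      hCA (heckePoint p r j'.1 j'.2 hp.pos τ) _ ?_
        (heckePoint_eq_of_exchange hp.pos (by rw [hdet]; exact one_ne_zero) h₁₁ h₁₂ h₂₁ h₂₂ hmap)⟩
    exact ((le_div_iff₀ hpos).2 hτ).trans (im_div_le_im_heckePoint hp.pos τ)
  choose C A hCA using hterm
  obtain ⟨A₀, hA₀⟩ := (Set.finite_range A).bddAbove
  refine ⟨∑ j, C j, A₀, fun τ τ' hτ hmap => ?_⟩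
  rw [heckeT_eq_sum]
  exact norm_sum_le_of_le _ fun j _ => hCA j τ τ' ((hA₀ ⟨j, rfl⟩).trans hτ) hmap

/-- For `p ∤ N` prime and `r ≥ 1`, the Hecke operator `T(p^r)` preserves `M₀^{!,∞}(Γ)`. -/
theorem statement8 (N : ℕ) (hN : 0 < N) (S : Finset ℕ)
    (hS : ∀ Q ∈ S, Q ∣ N ∧ Nat.gcd Q (N / Q) = 1)
    (p : ℕ) (hp : p.Prime) (hpN : ¬ p ∣ N) (r : ℕ) (hr : 0 < r)
    (f : UpperHalfPlane → ℂ) (hf : MemM0 N S f) :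
    MemM0 N S (heckeT p r hp.pos f) := by
  obtain ⟨hholo, hinv, hAL, hexp, hbdd⟩ := hf
  have hSN : ∀ Q ∈ S, Q ∣ N := fun Q hQ => (hS Q hQ).1
  refine ⟨holoOnH_heckeT hp.pos hholo, ?_, ?_, exists_hasSum_heckeT hp.pos hexp,
    fun σa σb σc σd => bounded_heckeT hN hSN hp hpN hbdd⟩
  · rintro a b c d hdet ⟨z, rfl⟩
    have := moebInv_heckeT (Q := 1) (r := r) (f := f) (x := a) (y := b) (z := z) (w := d)
      (one_dvd N) hN hp hpN (fun x y z w h => by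
        have := hinv x y (N * z) w (by push_cast at h; linear_combination h) (dvd_mul_right _ _)
        simpa using this) (by push_cast; linear_combination hdet)
    simpa using this
  · intro Q hQ x y z w hdet
    rw [Matrix.det_fin_two_of] at hdet
    exact moebInv_heckeT (hSN Q hQ) hN hp hpN
      (fun x y z w h => hAL Q hQ x y z w (by rwa [Matrix.det_fin_two_of])) hdet
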